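/- Let α < β, let S = (0, ∞) × (α, β) ⊆ ℝ² with coordinates (s, t), and let V : S → ℝ be continuously differentiable with λ₀ ≤ V ≤ Λ₀ and |∂V/∂s| ≤ M on S, for constants 0 < λ₀ ≤ Λ₀ and M ≥ 0. Let u : S → ℝ be twice continuously differentiable with u > 0 on S, satisfying the reduced elliptic equation V·∂²u/∂s² + ∂²u/∂t² + (∂V/∂s)·(∂u/∂s) = 0 at every point of S. Then for every compact interval [α′, β′] ⊂ (α, β) there exists a constant C ≥ 1 such that C⁻¹·u(s + 1, t) ≤ u(s, t) ≤ C·u(s + 1, t) for all s ≥ 1 and t ∈ [α′, β′]; consequently there exist constants C′ > 0 and c > 0 such that u(s, t) ≥ C′·e^{−c·s} for all s ≥ 1 and t ∈ [α′, β′]. -/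

import Mathlib

/-- Partial derivative in the first coordinate direction `s` of `ℝ²`. -/
noncomputable def pd1 (f : ℝ × ℝ → ℝ) : ℝ × ℝ → ℝ := fun p => fderiv ℝ f p (1, 0)

/-- Partial derivative in the second coordinate direction `t` of `ℝ²`. -/
noncomputable def pd2 (f : ℝ × ℝ → ℝ) : ℝ × ℝ → ℝ := fun p => fderiv ℝ f p (0, 1)

open Set MeasureTheory Filter Topology

lemma DifferentiableAt.hasDerivAt_pd1 {f : ℝ × ℝ → ℝ} {s t : ℝ}
    (h : DifferentiableAt ℝ f (s, t)) : HasDerivAt (fun x => f (x, t)) (pd1 f (s, t)) s :=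
  h.hasFDerivAt.comp_hasDerivAt s ((hasDerivAt_id s).prodMk (hasDerivAt_const s t))

lemma DifferentiableAt.hasDerivAt_pd2 {f : ℝ × ℝ → ℝ} {s t : ℝ}
    (h : DifferentiableAt ℝ f (s, t)) : HasDerivAt (fun y => f (s, y)) (pd2 f (s, t)) t :=
  h.hasFDerivAt.comp_hasDerivAt t ((hasDerivAt_const t s).prodMk (hasDerivAt_id t))

lemma ContDiffOn.pd1 {f : ℝ × ℝ → ℝ} {S : Set (ℝ × ℝ)} (hS : IsOpen S) {m n : ℕ∞}
    (hf : ContDiffOn ℝ n f S) (hmn : m + 1 ≤ n) : ContDiffOn ℝ m (pd1 f) S :=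
  (hf.fderiv_of_isOpen hS (by exact_mod_cast hmn)).clm_apply contDiffOn_const

lemma ContDiffOn.pd2 {f : ℝ × ℝ → ℝ} {S : Set (ℝ × ℝ)} (hS : IsOpen S) {m n : ℕ∞}
    (hf : ContDiffOn ℝ n f S) (hmn : m + 1 ≤ n) : ContDiffOn ℝ m (pd2 f) S :=
  (hf.fderiv_of_isOpen hS (by exact_mod_cast hmn)).clm_apply contDiffOn_const

/-- The necessary second-order condition at a local maximum. -/
lemma IsLocalMax.deriv_deriv_nonpos {f : ℝ → ℝ} {x : ℝ} (h : IsLocalMax f x)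
    (hc : ContinuousAt f x) : deriv (deriv f) x ≤ 0 := by
  by_contra! hpos
  have hmin := isLocalMin_of_deriv_deriv_pos hpos h.deriv_eq_zero hc
  have hconst : f =ᶠ[𝓝 x] fun _ => f x := by
    filter_upwards [h, hmin] with y h1 h2 using le_antisymm h1 h2
  have : deriv (deriv f) x = 0 := by
    rw [hconst.deriv.deriv_eq]
    simp
  linarith

/-- The second-order condition at a local maximum, for a function with explicitly given first and
second derivatives. -/
lemma IsLocalMax.second_deriv_nonpos {f f' : ℝ → ℝ} {f'' x : ℝ} (h : IsLocalMax f x)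
    (hf : ∀ᶠ y in 𝓝 x, HasDerivAt f (f' y) y) (hf' : HasDerivAt f' f'' x) : f'' ≤ 0 := by
  have h1 : deriv f =ᶠ[𝓝 x] f' := hf.mono fun y hy => hy.deriv
  have h2 := h.deriv_deriv_nonpos hf.self_of_nhds.continuousAt
  rwa [h1.deriv_eq, hf'.deriv] at h2

/-- A bound for the oscillation on an interval by the square integral of the derivative. -/
lemma abs_sub_le_of_setIntegral_sq_le {f f' : ℝ → ℝ} {a b K : ℝ}
    (hf : ∀ x ∈ Icc a b, HasDerivAt f (f' x) x) (hc : ContinuousOn f' (Icc a b))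
    (hK : ∫ x in Icc a b, f' x ^ 2 ≤ K) {x y : ℝ} (hx : x ∈ Icc a b) (hy : y ∈ Icc a b) :
    |f x - f y| ≤ b - a + K := by
  wlog hxy : y ≤ x generalizing x y
  · rw [abs_sub_comm]
    exact this hy hx (le_of_not_ge hxy)
  have hab : a ≤ b := hx.1.trans hx.2
  have hsub : Icc y x ⊆ Icc a b := Icc_subset_Icc hy.1 hx.2
  have hint : IntervalIntegrable f' volume y x :=
    ContinuousOn.intervalIntegrable_of_Icc hxy (hc.mono hsub)
  have hftc := intervalIntegral.integral_eq_sub_of_hasDerivAt_of_le hxy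
    (fun z hz => (hf z (hsub hz)).continuousAt.continuousWithinAt)
    (fun z hz => hf z (hsub (Ioo_subset_Icc_self hz))) hint
  have hcg : ContinuousOn (fun z => 1 + f' z ^ 2) (Icc a b) := by fun_prop
  have hig : IntegrableOn (fun z => 1 + f' z ^ 2) (Icc a b) := hcg.integrableOn_Icc
  have hsq : IntegrableOn (fun z => f' z ^ 2) (Icc a b) := (hc.pow 2).integrableOn_Icc
  rw [← hftc]
  calc |∫ z in y..x, f' z| ≤ ∫ z in y..x, |f' z| :=
        intervalIntegral.abs_integral_le_integral_abs hxy
    _ ≤ ∫ z in y..x, (1 + f' z ^ 2) := by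
        refine intervalIntegral.integral_mono_on hxy hint.abs
          (ContinuousOn.intervalIntegrable_of_Icc hxy (hcg.mono hsub)) fun z _ => ?_
        rw [abs_le]
        constructor <;> nlinarith [sq_nonneg (f' z - 1), sq_nonneg (f' z + 1)]
    _ = ∫ z in Icc y x, (1 + f' z ^ 2) := by
        rw [intervalIntegral.integral_of_le hxy, integral_Icc_eq_integral_Ioc]
    _ ≤ ∫ z in Icc a b, (1 + f' z ^ 2) :=
        setIntegral_mono_set hig (Eventually.of_forall fun z => by positivity)
          hsub.eventuallyLE
    _ = b - a + ∫ z in Icc a b, f' z ^ 2 := by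
        rw [integral_add (integrable_const _) hsq]
        simp [hab]
    _ ≤ b - a + K := by linarith

/-- A slice on which the integral is at most the average of the slice integrals. -/
lemma exists_slice_setIntegral_le {h : ℝ × ℝ → ℝ} {x₁ x₂ y₁ y₂ K : ℝ} (hx : x₁ < x₂)
    (hc : ContinuousOn h (Icc x₁ x₂ ×ˢ Icc y₁ y₂))
    (hK : ∫ z in Icc x₁ x₂ ×ˢ Icc y₁ y₂, h z ≤ K) :
    ∃ x ∈ Icc x₁ x₂, ∫ y in Icc y₁ y₂, h (x, y) ≤ K / (x₂ - x₁) := by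
  have hi : IntegrableOn h (Icc x₁ x₂ ×ˢ Icc y₁ y₂) :=
    hc.integrableOn_compact (isCompact_Icc.prod isCompact_Icc)
  have hi' : IntegrableOn h (Icc x₁ x₂ ×ˢ Icc y₁ y₂) (volume.prod volume) := hi
  rw [Measure.volume_eq_prod, setIntegral_prod h hi'] at hK
  have hG : IntegrableOn (fun x => ∫ y in Icc y₁ y₂, h (x, y)) (Icc x₁ x₂) := by
    rw [IntegrableOn, ← Measure.prod_restrict] at hi'
    exact hi'.integral_prod_left
  obtain ⟨x, hxm, hle⟩ := exists_le_setAverage (by simp [hx]) (by simp) hG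
  refine ⟨x, hxm, hle.trans ?_⟩
  rw [setAverage_eq, smul_eq_mul, div_eq_inv_mul]
  have : volume.real (Icc x₁ x₂) = x₂ - x₁ := by simp [hx.le]
  rw [this]
  exact mul_le_mul_of_nonneg_left hK (inv_nonneg.2 (by linarith))

lemma exists_slice_setIntegral_le' {h : ℝ × ℝ → ℝ} {x₁ x₂ y₁ y₂ K : ℝ} (hy : y₁ < y₂)
    (hc : ContinuousOn h (Icc x₁ x₂ ×ˢ Icc y₁ y₂))
    (hK : ∫ z in Icc x₁ x₂ ×ˢ Icc y₁ y₂, h z ≤ K) :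
    ∃ y ∈ Icc y₁ y₂, ∫ x in Icc x₁ x₂, h (x, y) ≤ K / (y₂ - y₁) := by
  refine exists_slice_setIntegral_le (h := fun z => h z.swap) hy
    (hc.comp continuous_swap.continuousOn fun z hz => ⟨hz.2, hz.1⟩) ?_
  rw [Measure.volume_eq_prod] at hK ⊢
  rwa [setIntegral_prod_swap]

/-- The weak maximum principle on rectangles. -/
lemma le_of_boundary_le {S : Set (ℝ × ℝ)} (hS : IsOpen S) {V b w : ℝ × ℝ → ℝ} {lam M : ℝ}
    (hlam : 0 < lam) (hVlow : ∀ x ∈ S, lam ≤ V x) (hb : ∀ x ∈ S, |b x| ≤ M)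
    (hw : ContDiffOn ℝ 2 w S)
    (hsub : ∀ x ∈ S, 0 ≤ V x * pd1 (pd1 w) x + pd2 (pd2 w) x + b x * pd1 w x)
    {x₁ x₂ y₁ y₂ m : ℝ} (hR : Icc x₁ x₂ ×ˢ Icc y₁ y₂ ⊆ S)
    (hm : ∀ z ∈ Icc x₁ x₂ ×ˢ Icc y₁ y₂, (z.1 = x₁ ∨ z.1 = x₂ ∨ z.2 = y₁ ∨ z.2 = y₂) → w z ≤ m)
    {z : ℝ × ℝ} (hz : z ∈ Icc x₁ x₂ ×ˢ Icc y₁ y₂) : w z ≤ m := by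
  by_contra! hlt
  have hM : 0 ≤ M := (abs_nonneg _).trans (hb z (hR hz))
  set k : ℝ := M / lam + 1 with hk
  have hkpos : 0 < k := by positivity
  have hkl : lam * k = M + lam := by rw [hk]; field_simp
  set ε : ℝ := (w z - m) / 2 * Real.exp (-(k * x₂)) with hε
  have hεpos : 0 < ε := mul_pos (by linarith) (Real.exp_pos _)
  have hεle : ∀ x ≤ x₂, ε * Real.exp (k * x) ≤ (w z - m) / 2 := by
    intro x hx
    rw [hε, mul_assoc, ← Real.exp_add]
    have : Real.exp (-(k * x₂) + k * x) ≤ 1 := Real.exp_le_one_iff.2 (by nlinarith)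
    nlinarith
  have hwc : ContinuousOn w S := hw.continuousOn
  obtain ⟨⟨s, t⟩, hmem, hmax⟩ := (isCompact_Icc.prod isCompact_Icc).exists_isMaxOn ⟨z, hz⟩
    (f := fun z : ℝ × ℝ => w z + ε * Real.exp (k * z.1)) (by
      have := hwc.mono hR
      fun_prop)
  have hzle : w z + ε * Real.exp (k * z.1) ≤ w (s, t) + ε * Real.exp (k * s) := hmax hz
  have hwm : m < w (s, t) := by
    have := hεle s hmem.1.2
    have : 0 < ε * Real.exp (k * z.1) := by positivity
    linarith
  have hne := fun h => (hm (s, t) hmem h).not_gt hwm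
  simp only [imp_false, not_or] at hne
  obtain ⟨hs1, hs2, ht1, ht2⟩ := hne
  have hs : s ∈ Ioo x₁ x₂ := ⟨lt_of_le_of_ne hmem.1.1 (Ne.symm hs1), lt_of_le_of_ne hmem.1.2 hs2⟩
  have ht : t ∈ Ioo y₁ y₂ := ⟨lt_of_le_of_ne hmem.2.1 (Ne.symm ht1), lt_of_le_of_ne hmem.2.2 ht2⟩
  have hst : (s, t) ∈ S := hR hmem
  have hd : ∀ x ∈ S, DifferentiableAt ℝ w x := fun x hx =>
    (hw.differentiableOn two_ne_zero).differentiableAt (hS.mem_nhds hx)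
  have hw2 : ContDiffOn ℝ ((2 : ℕ∞) : WithTop ℕ∞) w S := hw
  have hd1 : DifferentiableAt ℝ (pd1 w) (s, t) :=
    (((hw2.pd1 hS (m := 1) (by norm_num)).differentiableOn one_ne_zero).differentiableAt
      (hS.mem_nhds hst))
  have hd2 : DifferentiableAt ℝ (pd2 w) (s, t) :=
    (((hw2.pd2 hS (m := 1) (by norm_num)).differentiableOn one_ne_zero).differentiableAt
      (hS.mem_nhds hst))
  have hE : ∀ x, HasDerivAt (fun x => Real.exp (k * x)) (Real.exp (k * x) * k) x := fun x => by
    simpa using ((hasDerivAt_id x).const_mul k).exp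
  have hmax1 : IsLocalMax (fun x => w (x, t) + ε * Real.exp (k * x)) s := by
    filter_upwards [Ioo_mem_nhds hs.1 hs.2] with x hx
    exact hmax (show (x, t) ∈ _ from ⟨Ioo_subset_Icc_self hx, hmem.2⟩)
  have hmax2 : IsLocalMax (fun y => w (s, y)) t := by
    filter_upwards [Ioo_mem_nhds ht.1 ht.2] with y hy
    have : w (s, y) + ε * Real.exp (k * s) ≤ w (s, t) + ε * Real.exp (k * s) :=
      hmax (show (s, y) ∈ _ from ⟨hmem.1, Ioo_subset_Icc_self hy⟩)
    linarith
  have hder1 : ∀ x ∈ Icc x₁ x₂, HasDerivAt (fun x => w (x, t) + ε * Real.exp (k * x))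
      (pd1 w (x, t) + ε * (Real.exp (k * x) * k)) x := fun x hx =>
    (hd (x, t) (hR ⟨hx, hmem.2⟩)).hasDerivAt_pd1.add ((hE x).const_mul ε)
  have h1 : pd1 w (s, t) + ε * (Real.exp (k * s) * k) = 0 :=
    hmax1.hasDerivAt_eq_zero (hder1 s hmem.1)
  have h11 : pd1 (pd1 w) (s, t) + ε * (Real.exp (k * s) * k * k) ≤ 0 :=
    hmax1.second_deriv_nonpos
      (by filter_upwards [Ioo_mem_nhds hs.1 hs.2] with x hx using hder1 x (Ioo_subset_Icc_self hx))
      (hd1.hasDerivAt_pd1.add (((hE s).mul_const k).const_mul ε))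
  have h22 : pd2 (pd2 w) (s, t) ≤ 0 :=
    hmax2.second_deriv_nonpos
      (by filter_upwards [Ioo_mem_nhds ht.1 ht.2] with y hy using
            (hd (s, y) (hR ⟨hmem.1, Ioo_subset_Icc_self hy⟩)).hasDerivAt_pd2)
      hd2.hasDerivAt_pd2
  have hL := hsub _ hst
  have hV := hVlow _ hst
  have hB := abs_le.1 (hb _ hst)
  set e := ε * Real.exp (k * s) with he
  have hepos : 0 < e := by positivity
  have h1' : pd1 w (s, t) = -(e * k) := by linarith
  have h11' : V (s, t) * (pd1 (pd1 w) (s, t) + e * k * k) ≤ 0 :=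
    mul_nonpos_of_nonneg_of_nonpos (by linarith) (by linarith)
  rw [h1'] at hL
  have hek : 0 < e * k := by positivity
  have hA : e * k * (V (s, t) * k + b (s, t)) ≤ 0 := by linarith
  have hBpos : 0 < V (s, t) * k + b (s, t) := by nlinarith
  nlinarith

/-- The integral over a rectangle of the divergence of a field vanishing on the boundary is zero. -/
lemma setIntegral_divergence_eq_zero {f g : ℝ × ℝ → ℝ} {S : Set (ℝ × ℝ)} (hS : IsOpen S)
    (hf : ContDiffOn ℝ 1 f S) (hg : ContDiffOn ℝ 1 g S) {a b c d : ℝ} (hab : a ≤ b) (hcd : c ≤ d)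
    (hR : Icc a b ×ˢ Icc c d ⊆ S) (hfa : ∀ y, f (a, y) = 0) (hfb : ∀ y, f (b, y) = 0)
    (hgc : ∀ x, g (x, c) = 0) (hgd : ∀ x, g (x, d) = 0) :
    ∫ x in Icc a b ×ˢ Icc c d, (pd1 f x + pd2 g x) = 0 := by
  have hIcc : Icc (a, c) (b, d) = Icc a b ×ˢ Icc c d := (Icc_prod_Icc a b c d).symm
  have hsub : Ioo a b ×ˢ Ioo c d ⊆ S :=
    (Set.prod_mono Ioo_subset_Icc_self Ioo_subset_Icc_self).trans hR
  have hf1 : ContDiffOn ℝ ((1 : ℕ∞) : WithTop ℕ∞) f S := hf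
  have hg1 : ContDiffOn ℝ ((1 : ℕ∞) : WithTop ℕ∞) g S := hg
  have hcont : ContinuousOn (fun x => pd1 f x + pd2 g x) S :=
    (hf1.pd1 hS (m := 0) (by norm_num)).continuousOn.add
      (hg1.pd2 hS (m := 0) (by norm_num)).continuousOn
  have hd : ∀ F : ℝ × ℝ → ℝ, ContDiffOn ℝ 1 F S → ∀ x ∈ Ioo a b ×ˢ Ioo c d \ ∅,
      HasFDerivAt F (fderiv ℝ F x) x := fun F hF x hx =>
    ((hF.differentiableOn one_ne_zero).differentiableAt (hS.mem_nhds (hsub hx.1))).hasFDerivAt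
  have key := integral_divergence_prod_Icc_of_hasFDerivAt_off_countable_of_le f g
    (fderiv ℝ f) (fderiv ℝ g) (a, c) (b, d) ⟨hab, hcd⟩ ∅ countable_empty
    (hIcc ▸ hf.continuousOn.mono hR) (hIcc ▸ hg.continuousOn.mono hR) (hd f hf) (hd g hg)
    (hIcc ▸ (hcont.mono hR).integrableOn_compact (isCompact_Icc.prod isCompact_Icc))
  rw [hIcc] at key
  simp only [hfa, hfb, hgc, hgd, intervalIntegral.integral_zero, sub_zero, add_zero] at key
  exact key

/-- A polynomial cutoff vanishing on the boundary of the rectangle `[a, b] × [c, d]`. -/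
def rectCutoff (a b c d : ℝ) (z : ℝ × ℝ) : ℝ := (z.1 - a) * (b - z.1) * ((z.2 - c) * (d - z.2))

/-- The Caccioppoli estimate for a pair `(p, q)`, the gradient of the logarithm of a positive
solution. -/
lemma setIntegral_rectCutoff_sq_mul_energy_le {S : Set (ℝ × ℝ)} (hS : IsOpen S)
    {V p q : ℝ × ℝ → ℝ} {Lam : ℝ} (hV : ContDiffOn ℝ 1 V S) (hp : ContDiffOn ℝ 1 p S)
    (hq : ContDiffOn ℝ 1 q S) (hV0 : ∀ x ∈ S, 0 ≤ V x) (hVup : ∀ x ∈ S, V x ≤ Lam)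
    (hdiv : ∀ x ∈ S, pd1 (fun y => V y * p y) x + pd2 q x = -(V x * p x ^ 2 + q x ^ 2))
    {a b c d : ℝ} (hab : a ≤ b) (hcd : c ≤ d) (hR : Icc a b ×ˢ Icc c d ⊆ S) :
    ∫ z in Icc a b ×ˢ Icc c d, rectCutoff a b c d z ^ 2 * (V z * p z ^ 2 + q z ^ 2) ≤
      4 * (Lam * ((b - a) * (d - c) ^ 2) ^ 2 + ((b - a) ^ 2 * (d - c)) ^ 2) *
        ((b - a) * (d - c)) := by
  set φ := rectCutoff a b c d with hφ
  have hφC : ContDiff ℝ 1 φ := by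
    unfold φ rectCutoff
    fun_prop
  have hA : ContDiffOn ℝ 1 (fun y => V y * p y) S := hV.mul hp
  have hf : ContDiffOn ℝ 1 (fun z => φ z ^ 2 * (V z * p z)) S := (hφC.contDiffOn.pow 2).mul hA
  have hg : ContDiffOn ℝ 1 (fun z => φ z ^ 2 * q z) S := (hφC.contDiffOn.pow 2).mul hq
  have hzero := setIntegral_divergence_eq_zero hS hf hg hab hcd hR (by simp [hφ, rectCutoff])
    (by simp [hφ, rectCutoff]) (by simp [hφ, rectCutoff]) (by simp [hφ, rectCutoff])
  set k := 2 * (Lam * ((b - a) * (d - c) ^ 2) ^ 2 + ((b - a) ^ 2 * (d - c)) ^ 2) with hk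
  have hpt : ∀ z ∈ Icc a b ×ˢ Icc c d,
      φ z ^ 2 * (V z * p z ^ 2 + q z ^ 2) ≤
        2 * k - 2 * (pd1 (fun z => φ z ^ 2 * (V z * p z)) z + pd2 (fun z => φ z ^ 2 * q z) z) := by
    rintro ⟨s, t⟩ hz
    have hzS := hR hz
    have hnhds := hS.mem_nhds hzS
    have e1 : pd1 (fun z => φ z ^ 2 * (V z * p z)) (s, t) =
        2 * φ (s, t) * ((a + b - 2 * s) * ((t - c) * (d - t))) * (V (s, t) * p (s, t)) +
          φ (s, t) ^ 2 * pd1 (fun y => V y * p y) (s, t) := by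
      have h1 := ((hf.differentiableOn one_ne_zero).differentiableAt hnhds).hasDerivAt_pd1
      have h2 := ((hA.differentiableOn one_ne_zero).differentiableAt hnhds).hasDerivAt_pd1
      have h3 : HasDerivAt (fun x => φ (x, t)) ((a + b - 2 * s) * ((t - c) * (d - t))) s :=
        ((((hasDerivAt_id s).sub_const a).mul ((hasDerivAt_id s).const_sub b)).mul_const
          ((t - c) * (d - t))).congr_deriv (by simp only [id]; ring)
      exact (h1.unique ((h3.pow 2).mul h2)).trans (by simp)
    have e2 : pd2 (fun z => φ z ^ 2 * q z) (s, t) =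
        2 * φ (s, t) * ((s - a) * (b - s) * (c + d - 2 * t)) * q (s, t) +
          φ (s, t) ^ 2 * pd2 q (s, t) := by
      have h1 := ((hg.differentiableOn one_ne_zero).differentiableAt hnhds).hasDerivAt_pd2
      have h2 := ((hq.differentiableOn one_ne_zero).differentiableAt hnhds).hasDerivAt_pd2
      have h3 : HasDerivAt (fun y => φ (s, y)) ((s - a) * (b - s) * (c + d - 2 * t)) t :=
        ((((hasDerivAt_id t).sub_const c).mul ((hasDerivAt_id t).const_sub d)).const_mul
          ((s - a) * (b - s))).congr_deriv (by simp only [id]; ring)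
      exact (h1.unique ((h3.pow 2).mul h2)).trans (by simp)
    have hdv := hdiv _ hzS
    have hV0' := hV0 _ hzS
    have hVup' := hVup _ hzS
    obtain ⟨⟨hsa, hsb⟩, htc, htd⟩ := hz
    simp only at hsa hsb htc htd
    have bs : |(a + b - 2 * s) * ((t - c) * (d - t))| ≤ (b - a) * (d - c) ^ 2 := by
      rw [abs_mul, abs_of_nonneg (mul_nonneg (sub_nonneg.2 htc) (sub_nonneg.2 htd)), pow_two]
      gcongr
      rw [abs_le]; constructor <;> linarith
    have bt : |(s - a) * (b - s) * (c + d - 2 * t)| ≤ (b - a) ^ 2 * (d - c) := by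
      rw [abs_mul, abs_of_nonneg (mul_nonneg (sub_nonneg.2 hsa) (sub_nonneg.2 hsb)), pow_two]
      gcongr
      rw [abs_le]; constructor <;> linarith
    have bs2 := sq_le_sq' (abs_le.1 bs).1 (abs_le.1 bs).2
    have bt2 := sq_le_sq' (abs_le.1 bt).1 (abs_le.1 bt).2
    rw [e1, e2]
    generalize (a + b - 2 * s) * ((t - c) * (d - t)) = X at *
    generalize (s - a) * (b - s) * (c + d - 2 * t) = Y at *
    generalize pd1 (fun y => V y * p y) (s, t) = D1 at *
    generalize pd2 q (s, t) = D2 at *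
    generalize φ (s, t) = f at *
    generalize V (s, t) = v at *
    generalize p (s, t) = P at *
    generalize q (s, t) = Q at *
    have hD2 : D2 = -(v * P ^ 2 + Q ^ 2) - D1 := by linarith
    subst hD2
    have i1 : 0 ≤ v * (f * P - 2 * X) ^ 2 := by positivity
    have i2 : 0 ≤ (f * Q - 2 * Y) ^ 2 := by positivity
    have i3 : v * X ^ 2 ≤ Lam * ((b - a) * (d - c) ^ 2) ^ 2 :=
      mul_le_mul hVup' bs2 (sq_nonneg _) (hV0'.trans hVup')
    rw [hk]
    nlinarith
  have hcompact : IsCompact (Icc a b ×ˢ Icc c d) := isCompact_Icc.prod isCompact_Icc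
  have hf1 : ContDiffOn ℝ ((1 : ℕ∞) : WithTop ℕ∞) (fun z => φ z ^ 2 * (V z * p z)) S := hf
  have hg1 : ContDiffOn ℝ ((1 : ℕ∞) : WithTop ℕ∞) (fun z => φ z ^ 2 * q z) S := hg
  have hdI : IntegrableOn (fun z => pd1 (fun z => φ z ^ 2 * (V z * p z)) z +
      pd2 (fun z => φ z ^ 2 * q z) z) (Icc a b ×ˢ Icc c d) :=
    (((hf1.pd1 hS (m := 0) (by norm_num)).continuousOn.add
      (hg1.pd2 hS (m := 0) (by norm_num)).continuousOn).mono hR).integrableOn_compact hcompact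
  have hEI : IntegrableOn (fun z => φ z ^ 2 * (V z * p z ^ 2 + q z ^ 2))
      (Icc a b ×ˢ Icc c d) := by
    have h1 := hV.continuousOn.mono hR
    have h2 := hp.continuousOn.mono hR
    have h3 := hq.continuousOn.mono hR
    have h4 := hφC.continuous
    have h5 : ContinuousOn (fun z => φ z ^ 2 * (V z * p z ^ 2 + q z ^ 2))
      (Icc a b ×ˢ Icc c d) := by fun_prop
    exact h5.integrableOn_compact hcompact
  have hkI : IntegrableOn (fun _ : ℝ × ℝ => 2 * k) (Icc a b ×ˢ Icc c d) :=
    continuousOn_const.integrableOn_compact hcompact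
  refine (setIntegral_mono_on hEI (hkI.sub (hdI.const_mul 2))
    (measurableSet_Icc.prod measurableSet_Icc) hpt).trans_eq ?_
  rw [integral_sub' hkI (hdI.const_mul 2), setIntegral_const, integral_const_mul, hzero,
    Measure.volume_eq_prod, measureReal_prod_prod]
  simp [hab, hcd, hk]
  ring

/-- The Courant–Lebesgue argument: a function of bounded Dirichlet energy has bounded oscillation
on the boundary of a suitable rectangle. -/
lemma exists_rect_boundary_oscillation_le {v p q : ℝ × ℝ → ℝ} {a b c d δ K : ℝ} (hδ : 0 < δ)
    (hab : a ≤ b) (hcd : c ≤ d)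
    (hp : ∀ s t, (s, t) ∈ Icc (a - δ) (b + δ) ×ˢ Icc (c - δ) (d + δ) →
      HasDerivAt (fun x => v (x, t)) (p (s, t)) s)
    (hq : ∀ s t, (s, t) ∈ Icc (a - δ) (b + δ) ×ˢ Icc (c - δ) (d + δ) →
      HasDerivAt (fun y => v (s, y)) (q (s, t)) t)
    (hpc : ContinuousOn p (Icc (a - δ) (b + δ) ×ˢ Icc (c - δ) (d + δ)))
    (hqc : ContinuousOn q (Icc (a - δ) (b + δ) ×ˢ Icc (c - δ) (d + δ)))
    (hK : ∫ z in Icc (a - δ) (b + δ) ×ˢ Icc (c - δ) (d + δ), (p z ^ 2 + q z ^ 2) ≤ K) :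
    ∃ x₁ ∈ Icc (a - δ) a, ∃ x₂ ∈ Icc b (b + δ), ∃ y₁ ∈ Icc (c - δ) c, ∃ y₂ ∈ Icc d (d + δ),
      ∀ z ∈ Icc x₁ x₂ ×ˢ Icc y₁ y₂, (z.1 = x₁ ∨ z.1 = x₂ ∨ z.2 = y₁ ∨ z.2 = y₂) →
        |v z - v (x₁, y₁)| ≤ 2 * ((b - a) + (d - c) + 4 * δ + K / δ) := by
  set I := Icc (a - δ) (b + δ) with hI
  set J := Icc (c - δ) (d + δ) with hJ
  have hE : ContinuousOn (fun z => p z ^ 2 + q z ^ 2) (I ×ˢ J) := (hpc.pow 2).add (hqc.pow 2)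
  have hEi : IntegrableOn (fun z => p z ^ 2 + q z ^ 2) (I ×ˢ J) :=
    hE.integrableOn_compact (isCompact_Icc.prod isCompact_Icc)
  have hmono : ∀ {T : Set (ℝ × ℝ)}, T ⊆ I ×ˢ J → ∫ z in T, (p z ^ 2 + q z ^ 2) ≤ K := fun hT =>
    (setIntegral_mono_set hEi (Eventually.of_forall fun z => by positivity)
      hT.eventuallyLE).trans hK
  have vert : ∀ x' x'', x'' - x' = δ → Icc x' x'' ⊆ I →
      ∃ x ∈ Icc x' x'', ∀ t ∈ J, ∀ t' ∈ J,
        |v (x, t) - v (x, t')| ≤ (b - a) + (d - c) + 4 * δ + K / δ := by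
    intro x' x'' hx hsub
    obtain ⟨x, hxm, hle⟩ := exists_slice_setIntegral_le (by linarith : x' < x'')
      (hE.mono (Set.prod_mono hsub subset_rfl)) (hmono (Set.prod_mono hsub subset_rfl))
    have hmap : MapsTo (fun t => (x, t)) J (I ×ˢ J) := fun t ht => ⟨hsub hxm, ht⟩
    have hpair : ContinuousOn (fun t : ℝ => (x, t)) J := by fun_prop
    have hqx : ContinuousOn (fun t => q (x, t)) J := hqc.comp hpair hmap
    have hEx : ContinuousOn (fun t => p (x, t) ^ 2 + q (x, t) ^ 2) J := hE.comp hpair hmap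
    rw [hx] at hle
    have hle' : ∫ t in J, q (x, t) ^ 2 ≤ K / δ :=
      (setIntegral_mono_on (hqx.pow 2).integrableOn_Icc hEx.integrableOn_Icc measurableSet_Icc
        fun t _ => le_add_of_nonneg_left (sq_nonneg (p (x, t)))).trans hle
    refine ⟨x, hxm, fun t ht t' ht' => ?_⟩
    have := abs_sub_le_of_setIntegral_sq_le (fun y hy => hq x y (hmap hy)) hqx hle' ht ht'
    linarith
  have horiz : ∀ y' y'', y'' - y' = δ → Icc y' y'' ⊆ J →
      ∃ y ∈ Icc y' y'', ∀ s ∈ I, ∀ s' ∈ I,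
        |v (s, y) - v (s', y)| ≤ (b - a) + (d - c) + 4 * δ + K / δ := by
    intro y' y'' hy hsub
    obtain ⟨y, hym, hle⟩ := exists_slice_setIntegral_le' (by linarith : y' < y'')
      (hE.mono (Set.prod_mono subset_rfl hsub)) (hmono (Set.prod_mono subset_rfl hsub))
    have hmap : MapsTo (fun s => (s, y)) I (I ×ˢ J) := fun s hs => ⟨hs, hsub hym⟩
    have hpair : ContinuousOn (fun s : ℝ => (s, y)) I := by fun_prop
    have hpy : ContinuousOn (fun s => p (s, y)) I := hpc.comp hpair hmap
    have hEy : ContinuousOn (fun s => p (s, y) ^ 2 + q (s, y) ^ 2) I := hE.comp hpair hmap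
    rw [hy] at hle
    have hle' : ∫ s in I, p (s, y) ^ 2 ≤ K / δ :=
      (setIntegral_mono_on (hpy.pow 2).integrableOn_Icc hEy.integrableOn_Icc measurableSet_Icc
        fun s _ => le_add_of_nonneg_right (sq_nonneg (q (s, y)))).trans hle
    refine ⟨y, hym, fun s hs s' hs' => ?_⟩
    have := abs_sub_le_of_setIntegral_sq_le (fun x hx => hp x y (hmap hx)) hpy hle' hs hs'
    linarith
  obtain ⟨x₁, hx₁, h1⟩ := vert (a - δ) a (by ring) (Icc_subset_Icc le_rfl (by linarith))
  obtain ⟨x₂, hx₂, h2⟩ := vert b (b + δ) (by ring) (Icc_subset_Icc (by linarith) le_rfl)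
  obtain ⟨y₁, hy₁, h3⟩ := horiz (c - δ) c (by ring) (Icc_subset_Icc le_rfl (by linarith))
  obtain ⟨y₂, hy₂, h4⟩ := horiz d (d + δ) (by ring) (Icc_subset_Icc (by linarith) le_rfl)
  refine ⟨x₁, hx₁, x₂, hx₂, y₁, hy₁, y₂, hy₂, ?_⟩
  have mx₁ : x₁ ∈ I := ⟨hx₁.1, by linarith [hx₁.2]⟩
  have mx₂ : x₂ ∈ I := ⟨by linarith [hx₂.1], hx₂.2⟩
  have my₁ : y₁ ∈ J := ⟨hy₁.1, by linarith [hy₁.2]⟩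
  have my₂ : y₂ ∈ J := ⟨by linarith [hy₂.1], hy₂.2⟩
  rintro ⟨s, t⟩ ⟨hs, ht⟩ hz
  have ms : s ∈ I := Icc_subset_Icc mx₁.1 mx₂.2 hs
  have mt : t ∈ J := Icc_subset_Icc my₁.1 my₂.2 ht
  have tri : ∀ w, |v (s, t) - v w| ≤ (b - a) + (d - c) + 4 * δ + K / δ →
      |v w - v (x₁, y₁)| ≤ (b - a) + (d - c) + 4 * δ + K / δ →
      |v (s, t) - v (x₁, y₁)| ≤ 2 * ((b - a) + (d - c) + 4 * δ + K / δ) := fun w h h' => by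
    linarith [abs_sub_le (v (s, t)) (v w) (v (x₁, y₁))]
  simp only at hz
  rcases hz with rfl | rfl | rfl | rfl
  · exact tri (s, y₁) (h1 t mt y₁ my₁) (h1 y₁ my₁ y₁ my₁)
  · exact tri (s, y₁) (h2 t mt y₁ my₁) (h3 s ms x₁ mx₁)
  · exact tri (x₁, t) (h3 s ms x₁ mx₁) (h3 x₁ mx₁ x₁ mx₁)
  · exact tri (x₁, t) (h4 s ms x₁ mx₁) (h1 t mt y₁ my₁)

/-- The equation satisfied by the gradient of the logarithm of a positive solution. -/
lemma divergence_log_gradient {S : Set (ℝ × ℝ)} (hS : IsOpen S) {V u : ℝ × ℝ → ℝ}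
    (hV : ContDiffOn ℝ 1 V S) (hu : ContDiffOn ℝ 2 u S) (hupos : ∀ x ∈ S, 0 < u x)
    (heq : ∀ x ∈ S, V x * pd1 (pd1 u) x + pd2 (pd2 u) x + pd1 V x * pd1 u x = 0)
    {x : ℝ × ℝ} (hx : x ∈ S) :
    pd1 (fun y => V y * (pd1 u y / u y)) x + pd2 (fun y => pd2 u y / u y) x =
      -(V x * (pd1 u x / u x) ^ 2 + (pd2 u x / u x) ^ 2) := by
  obtain ⟨s, t⟩ := x
  have hnhds := hS.mem_nhds hx
  have hu2 : ContDiffOn ℝ ((2 : ℕ∞) : WithTop ℕ∞) u S := hu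
  have hne := (hupos _ hx).ne'
  have hu1 : ContDiffOn ℝ 1 u S := hu.of_le one_le_two
  have hu0 : ∀ y ∈ S, u y ≠ 0 := fun y hy => (hupos y hy).ne'
  have h1 : ContDiffOn ℝ 1 (pd1 u) S := hu2.pd1 hS (m := 1) (by norm_num)
  have h2 : ContDiffOn ℝ 1 (pd2 u) S := hu2.pd2 hS (m := 1) (by norm_num)
  have hd : ∀ {f : ℝ × ℝ → ℝ}, ContDiffOn ℝ 1 f S → DifferentiableAt ℝ f (s, t) := fun hf =>
    (hf.differentiableOn one_ne_zero).differentiableAt hnhds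
  have e1 := (hd (hV.mul (h1.div hu1 hu0))).hasDerivAt_pd1.unique
    ((hd hV).hasDerivAt_pd1.mul ((hd h1).hasDerivAt_pd1.fun_div (hd hu1).hasDerivAt_pd1 hne))
  have e2 := (hd (h2.div hu1 hu0)).hasDerivAt_pd2.unique
    ((hd h2).hasDerivAt_pd2.fun_div (hd hu1).hasDerivAt_pd2 hne)
  refine (congrArg₂ (· + ·) e1 e2).trans ?_
  simp only [Pi.div_apply]
  have := heq _ hx
  field_simp
  linear_combination u (s, t) * this

/-- Harnack's inequality on a rectangle, with a constant depending only on the size of the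
rectangle and its margin in the domain. -/
lemma exists_harnack_const {S : Set (ℝ × ℝ)} (hS : IsOpen S) {V u : ℝ × ℝ → ℝ} {lam Lam M : ℝ}
    (hlam : 0 < lam) (hlL : lam ≤ Lam) (hV : ContDiffOn ℝ 1 V S) (hVlow : ∀ x ∈ S, lam ≤ V x)
    (hVup : ∀ x ∈ S, V x ≤ Lam) (hVs : ∀ x ∈ S, |pd1 V x| ≤ M) (hu : ContDiffOn ℝ 2 u S)
    (hupos : ∀ x ∈ S, 0 < u x)
    (heq : ∀ x ∈ S, V x * pd1 (pd1 u) x + pd2 (pd2 u) x + pd1 V x * pd1 u x = 0)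
    {A B δ : ℝ} (hA : 0 ≤ A) (hB : 0 ≤ B) (hδ : 0 < δ) :
    ∃ C : ℝ, 1 ≤ C ∧ ∀ a c : ℝ,
      Icc (a - 2 * δ) (a + A + 2 * δ) ×ˢ Icc (c - 2 * δ) (c + B + 2 * δ) ⊆ S →
      ∀ z ∈ Icc a (a + A) ×ˢ Icc c (c + B), ∀ z' ∈ Icc a (a + A) ×ˢ Icc c (c + B),
        u z ≤ C * u z' := by
  set A' := A + 4 * δ with hA'
  set B' := B + 4 * δ with hB'
  have hLam : 0 < Lam := hlam.trans_le hlL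
  set E := 4 * (Lam * (A' * B' ^ 2) ^ 2 + (A' ^ 2 * B') ^ 2) * (A' * B') with hE
  set K := E / ((δ ^ 4) ^ 2 * min lam 1) with hK
  have hmin : 0 < min lam 1 := lt_min hlam one_pos
  have hKnn : 0 ≤ K := by positivity
  set D := 2 * (A + B + 4 * δ + K / δ) with hD
  have hDnn : 0 ≤ D := by positivity
  refine ⟨Real.exp (2 * D), Real.one_le_exp (by positivity), fun a c hR => ?_⟩
  set p : ℝ × ℝ → ℝ := fun y => pd1 u y / u y with hp
  set q : ℝ × ℝ → ℝ := fun y => pd2 u y / u y with hq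
  have hu2 : ContDiffOn ℝ ((2 : ℕ∞) : WithTop ℕ∞) u S := hu
  have hne : ∀ x ∈ S, u x ≠ 0 := fun x hx => (hupos x hx).ne'
  have hu1 : ContDiffOn ℝ 1 u S := hu.of_le one_le_two
  have hpC : ContDiffOn ℝ 1 p S := (hu2.pd1 hS (m := 1) (by norm_num)).div hu1 hne
  have hqC : ContDiffOn ℝ 1 q S := (hu2.pd2 hS (m := 1) (by norm_num)).div hu1 hne
  have henergy := setIntegral_rectCutoff_sq_mul_energy_le hS hV hpC hqC
    (fun x hx => hlam.le.trans (hVlow x hx)) hVup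
    (fun x hx => divergence_log_gradient hS hV hu hupos heq hx) (by linarith) (by linarith) hR
  rw [show a + A + 2 * δ - (a - 2 * δ) = A' by ring,
    show c + B + 2 * δ - (c - 2 * δ) = B' by ring, ← hE] at henergy
  set Q := Icc (a - δ) (a + A + δ) ×ˢ Icc (c - δ) (c + B + δ) with hQ
  set R := Icc (a - 2 * δ) (a + A + 2 * δ) ×ˢ Icc (c - 2 * δ) (c + B + 2 * δ) with hRdef
  have hQR : Q ⊆ R := Set.prod_mono (Icc_subset_Icc (by linarith) (by linarith))
    (Icc_subset_Icc (by linarith) (by linarith))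
  have hQS : Q ⊆ S := hQR.trans hR
  set φ := rectCutoff (a - 2 * δ) (a + A + 2 * δ) (c - 2 * δ) (c + B + 2 * δ) with hφ
  have hQK : ∫ z in Q, (p z ^ 2 + q z ^ 2) ≤ K := by
    have hcR : ContinuousOn (fun z => φ z ^ 2 * (V z * p z ^ 2 + q z ^ 2)) R := by
      have h1 := hV.continuousOn.mono hR
      have h2 := hpC.continuousOn.mono hR
      have h3 := hqC.continuousOn.mono hR
      have h4 : Continuous φ := by
        unfold φ rectCutoff
        fun_prop
      fun_prop
    have hcQ : ContinuousOn (fun z => p z ^ 2 + q z ^ 2) Q :=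
      ((hpC.continuousOn.mono hQS).pow 2).add ((hqC.continuousOn.mono hQS).pow 2)
    have hiR := hcR.integrableOn_compact (μ := volume) (isCompact_Icc.prod isCompact_Icc)
    have hiQ := hcQ.integrableOn_compact (μ := volume) (isCompact_Icc.prod isCompact_Icc)
    have hmR : MeasurableSet R := measurableSet_Icc.prod measurableSet_Icc
    have hmQ : MeasurableSet Q := measurableSet_Icc.prod measurableSet_Icc
    rw [hK, le_div_iff₀ (by positivity), mul_comm, ← integral_const_mul]
    calc ∫ z in Q, (δ ^ 4) ^ 2 * min lam 1 * (p z ^ 2 + q z ^ 2)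
        ≤ ∫ z in Q, φ z ^ 2 * (V z * p z ^ 2 + q z ^ 2) := by
          refine setIntegral_mono_on (hiQ.const_mul _) (hiR.mono_set hQR) hmQ fun z hz => ?_
          have hVz := hVlow z (hQS hz)
          obtain ⟨⟨h1, h2⟩, h3, h4⟩ := hz
          have hφz : δ ^ 4 ≤ φ z := by
            calc δ ^ 4 = δ * δ * (δ * δ) := by ring
              _ ≤ φ z := by
                have i1 : δ ≤ z.1 - (a - 2 * δ) := by linarith
                have i2 : δ ≤ a + A + 2 * δ - z.1 := by linarith
                have i3 : δ ≤ z.2 - (c - 2 * δ) := by linarith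
                have i4 : δ ≤ c + B + 2 * δ - z.2 := by linarith
                exact mul_le_mul (mul_le_mul i1 i2 hδ.le (hδ.le.trans i1))
                  (mul_le_mul i3 i4 hδ.le (hδ.le.trans i3)) (by positivity)
                  (mul_nonneg (hδ.le.trans i1) (hδ.le.trans i2))
          rw [mul_assoc]
          have hl := min_le_left lam 1
          have hr := min_le_right lam 1
          have : min lam 1 * (p z ^ 2 + q z ^ 2) ≤ V z * p z ^ 2 + q z ^ 2 := by
            nlinarith [sq_nonneg (p z), sq_nonneg (q z)]
          gcongr
      _ ≤ ∫ z in R, φ z ^ 2 * (V z * p z ^ 2 + q z ^ 2) := by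
          refine setIntegral_mono_set hiR ?_ hQR.eventuallyLE
          refine (ae_restrict_iff' hmR).2 (Eventually.of_forall fun z hz => ?_)
          have : 0 ≤ V z := hlam.le.trans (hVlow z (hR hz))
          simp only [Pi.zero_apply]
          positivity
      _ ≤ E := henergy
  have hdu : ∀ x ∈ S, DifferentiableAt ℝ u x := fun x hx =>
    (hu.differentiableOn two_ne_zero).differentiableAt (hS.mem_nhds hx)
  obtain ⟨x₁, hx₁, x₂, hx₂, y₁, hy₁, y₂, hy₂, hosc⟩ :=
    exists_rect_boundary_oscillation_le (v := fun z => Real.log (u z)) (p := p) (q := q)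
      (a := a) (b := a + A) (c := c) (d := c + B) (K := K) hδ
      (by linarith) (by linarith)
      (fun s t h => (hdu _ (hQS h)).hasDerivAt_pd1.log (hne _ (hQS h)))
      (fun s t h => (hdu _ (hQS h)).hasDerivAt_pd2.log (hne _ (hQS h)))
      (hpC.continuousOn.mono hQS) (hqC.continuousOn.mono hQS) hQK
  rw [show a + A - a + (c + B - c) + 4 * δ + K / δ = A + B + 4 * δ + K / δ by ring, ← hD] at hosc
  have hsubS : Icc x₁ x₂ ×ˢ Icc y₁ y₂ ⊆ S :=
    (Set.prod_mono (Icc_subset_Icc hx₁.1 hx₂.2) (Icc_subset_Icc hy₁.1 hy₂.2)).trans hQS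
  have hsub : Icc a (a + A) ×ˢ Icc c (c + B) ⊆ Icc x₁ x₂ ×ˢ Icc y₁ y₂ :=
    Set.prod_mono (Icc_subset_Icc hx₁.2 hx₂.1) (Icc_subset_Icc hy₁.2 hy₂.1)
  set v₀ := Real.log (u (x₁, y₁)) with hv₀
  have hup : ∀ z ∈ Icc x₁ x₂ ×ˢ Icc y₁ y₂, u z ≤ Real.exp (v₀ + D) := fun z hz =>
    le_of_boundary_le hS hlam hVlow hVs hu (fun x hx => (heq x hx).ge) hsubS
      (fun w hw hb => by
        have := (abs_le.1 (hosc w hw hb)).2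
        rw [← Real.log_le_iff_le_exp (hupos w (hsubS hw))]
        linarith) hz
  have hlow : ∀ z ∈ Icc x₁ x₂ ×ˢ Icc y₁ y₂, -u z ≤ -Real.exp (v₀ - D) := fun z hz => by
    have e1 : ∀ f : ℝ × ℝ → ℝ, pd1 (fun y => -f y) = fun y => -pd1 f y := fun f => by
      ext x
      simp [pd1, fderiv_fun_neg]
    have e2 : ∀ f : ℝ × ℝ → ℝ, pd2 (fun y => -f y) = fun y => -pd2 f y := fun f => by
      ext x
      simp [pd2, fderiv_fun_neg]
    refine le_of_boundary_le (w := fun z => -u z) hS hlam hVlow hVs hu.neg (fun x hx => ?_) hsubS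
      (fun w hw hb => ?_) hz
    · simp only [e1, e2]
      linarith [heq x hx]
    · have := (abs_le.1 (hosc w hw hb)).1
      rw [neg_le_neg_iff, ← Real.le_log_iff_exp_le (hupos w (hsubS hw))]
      linarith
  intro z hz z' hz'
  calc u z ≤ Real.exp (v₀ + D) := hup z (hsub hz)
    _ = Real.exp (2 * D) * Real.exp (v₀ - D) := by rw [← Real.exp_add]; ring_nf
    _ ≤ Real.exp (2 * D) * u z' := by
        gcongr
        exact neg_le_neg_iff.1 (hlow z' (hsub hz'))

/-- A positive function on a half-line of which each unit translation loses at most a constant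
factor decays at most exponentially. -/
lemma inv_pow_mul_le_of_unit_step {f : ℝ → ℝ} {C m : ℝ} (hC : 1 ≤ C) (hm : 0 ≤ m)
    (hstep : ∀ s, 1 ≤ s → f s ≤ C * f (s + 1)) (hbase : ∀ s ∈ Icc (1 : ℝ) 2, m ≤ f s)
    {s : ℝ} (hs : 1 ≤ s) : m * Real.exp (-(Real.log C + 1) * s) ≤ f s := by
  have hC0 : 0 < C := one_pos.trans_le hC
  have hn : ∀ n : ℕ, ∀ r ∈ Icc (1 : ℝ) 2, m ≤ C ^ n * f (r + n) := by
    intro n r hr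
    induction n with
    | zero => simpa using hbase r hr
    | succ n ih =>
      have hr1 : (1 : ℝ) ≤ r + n := hr.1.trans (by simp)
      calc m ≤ C ^ n * f (r + n) := ih
        _ ≤ C ^ n * (C * f (r + n + 1)) := by gcongr; exact hstep _ hr1
        _ = C ^ (n + 1) * f (r + (n + 1 : ℕ)) := by push_cast; ring_nf
  set n := ⌊s - 1⌋₊ with hn'
  have hfl : (n : ℝ) ≤ s - 1 := Nat.floor_le (by linarith)
  have hfl' : s - 1 < n + 1 := Nat.lt_floor_add_one _
  have key := hn n (s - n) ⟨by linarith, by linarith⟩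
  rw [sub_add_cancel] at key
  have hlog : 0 ≤ Real.log C := Real.log_nonneg hC
  have hexp : Real.exp (-(Real.log C + 1) * s) ≤ (C ^ n)⁻¹ := by
    rw [← Real.exp_log (pow_pos hC0 n), ← Real.exp_neg, Real.log_pow]
    apply Real.exp_le_exp.2
    nlinarith
  calc m * Real.exp (-(Real.log C + 1) * s) ≤ m * (C ^ n)⁻¹ := by gcongr
    _ ≤ f s := by
      rw [← div_eq_mul_inv, div_le_iff₀ (pow_pos hC0 n), mul_comm]
      exact key

/-- Harnack-chain estimate on the half-strip
`S = (0,∞) × (α,β)`: a positive solution of the reduced elliptic equation with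
uniformly elliptic bounded coefficients satisfies, on every compact
sub-interval, `C⁻¹·u(s+1,t) ≤ u(s,t) ≤ C·u(s+1,t)`, and hence decays at most
exponentially. -/
theorem harnack_chain_lower_exponential_bound
    (α β : ℝ) (hαβ : α < β)
    (S : Set (ℝ × ℝ)) (hS : S = Set.Ioi (0 : ℝ) ×ˢ Set.Ioo α β)
    (lam₀ Lam₀ M : ℝ) (hlam₀ : 0 < lam₀) (hlL : lam₀ ≤ Lam₀) (hM : 0 ≤ M)
    (V : ℝ × ℝ → ℝ) (hV : ContDiffOn ℝ 1 V S)
    (hVlow : ∀ x ∈ S, lam₀ ≤ V x) (hVup : ∀ x ∈ S, V x ≤ Lam₀)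
    (hVs : ∀ x ∈ S, |pd1 V x| ≤ M)
    (u : ℝ × ℝ → ℝ) (hu : ContDiffOn ℝ 2 u S) (hupos : ∀ x ∈ S, 0 < u x)
    (heq : ∀ x ∈ S, V x * pd1 (pd1 u) x + pd2 (pd2 u) x + pd1 V x * pd1 u x = 0) :
    ∀ α' β' : ℝ, α < α' → β' < β → α' ≤ β' →
      (∃ C : ℝ, 1 ≤ C ∧ ∀ s t : ℝ, 1 ≤ s → t ∈ Set.Icc α' β' →
        C⁻¹ * u (s + 1, t) ≤ u (s, t) ∧ u (s, t) ≤ C * u (s + 1, t)) ∧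
      (∃ C' c : ℝ, 0 < C' ∧ 0 < c ∧ ∀ s t : ℝ, 1 ≤ s → t ∈ Set.Icc α' β' →
        C' * Real.exp (-c * s) ≤ u (s, t)) := by
  intro α' β' hα hβ hαβ'
  have hSo : IsOpen S := hS ▸ isOpen_Ioi.prod isOpen_Ioo
  obtain ⟨δ, hδ, hδ1, hδα, hδβ⟩ : ∃ δ : ℝ, 0 < δ ∧ 4 * δ ≤ 1 ∧ 4 * δ ≤ α' - α ∧ 4 * δ ≤ β - β' := by
    refine ⟨min 1 (min (α' - α) (β - β')) / 4, ?_, ?_, ?_, ?_⟩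
    · have : 0 < min 1 (min (α' - α) (β - β')) :=
        lt_min one_pos (lt_min (sub_pos.2 hα) (sub_pos.2 hβ))
      positivity
    all_goals
      have h1 := min_le_left 1 (min (α' - α) (β - β'))
      have h2 := min_le_right 1 (min (α' - α) (β - β'))
      have h3 := min_le_left (α' - α) (β - β')
      have h4 := min_le_right (α' - α) (β - β')
      linarith
  obtain ⟨C, hC, hH⟩ := exists_harnack_const hSo hlam₀ hlL hV hVlow hVup hVs hu hupos heq
    zero_le_one (sub_nonneg.2 hαβ') hδ
  have hrect : ∀ s : ℝ, 1 ≤ s →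
      Set.Icc (s - 2 * δ) (s + 1 + 2 * δ) ×ˢ
        Set.Icc (α' - 2 * δ) (α' + (β' - α') + 2 * δ) ⊆ S := by
    rintro s hs ⟨x, y⟩ ⟨hx, hy⟩
    rw [hS]
    simp only [Set.mem_Icc] at hx hy
    exact ⟨show 0 < x by linarith, show α < y by linarith, show y < β by linarith⟩
  have hstep : ∀ s t : ℝ, 1 ≤ s → t ∈ Set.Icc α' β' →
      u (s + 1, t) ≤ C * u (s, t) ∧ u (s, t) ≤ C * u (s + 1, t) := by
    intro s t hs ht
    have ht' : t ∈ Set.Icc α' (α' + (β' - α')) := by rwa [add_sub_cancel]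
    have m1 : (s, t) ∈ Set.Icc s (s + 1) ×ˢ Set.Icc α' (α' + (β' - α')) :=
      ⟨⟨le_rfl, by simp⟩, ht'⟩
    have m2 : (s + 1, t) ∈ Set.Icc s (s + 1) ×ˢ Set.Icc α' (α' + (β' - α')) :=
      ⟨⟨by simp, le_rfl⟩, ht'⟩
    exact ⟨hH s α' (hrect s hs) _ m2 _ m1, hH s α' (hrect s hs) _ m1 _ m2⟩
  refine ⟨⟨C, hC, fun s t hs ht => ⟨?_, (hstep s t hs ht).2⟩⟩, ?_⟩
  · rw [inv_mul_le_iff₀ (one_pos.trans_le hC)]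
    exact (hstep s t hs ht).1
  have hbaseS : Set.Icc (1 : ℝ) 2 ×ˢ Set.Icc α' β' ⊆ S := by
    rw [hS]
    exact Set.prod_mono (fun x hx => lt_of_lt_of_le one_pos hx.1) (Set.Icc_subset_Ioo hα hβ)
  obtain ⟨z, hz, hmin⟩ := (isCompact_Icc.prod isCompact_Icc).exists_isMinOn
    (s := Set.Icc (1 : ℝ) 2 ×ˢ Set.Icc α' β') ⟨(1, α'), by simp [hαβ']⟩
    (hu.continuousOn.mono hbaseS)
  refine ⟨u z, Real.log C + 1, hupos z (hbaseS hz), by linarith [Real.log_nonneg hC],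
    fun s t hs ht => ?_⟩
  exact inv_pow_mul_le_of_unit_step (f := fun s => u (s, t)) hC (hupos z (hbaseS hz)).le
    (fun r hr => (hstep r t hr ht).2) (fun r hr => hmin (show (r, t) ∈ _ from ⟨hr, ht⟩)) hs
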